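/- arXiv:2304.03749 — 3 statements merged into one kernel-verified Lean document; each statement's English description precedes it below -/
import Mathlib

section
/- Let Λ be a finite nonempty set, let ε ≥ 0, Δ > 0, let π : Λ → ℝ be a strictly positive prior weight function, and let ℓ, ℓ' : Λ → ℝ be two score functions satisfying |ℓ(λ) − ℓ'(λ)| ≤ Δ for every λ ∈ Λ. Define the exponential-mechanism output distributions P(λ) = π(λ)·exp(ε·ℓ(λ)/(2Δ)) / Σ_{λ'∈Λ} π(λ')·exp(ε·ℓ(λ')/(2Δ)) and P'(λ) = π(λ)·exp(ε·ℓ'(λ)/(2Δ)) / Σ_{λ'∈Λ} π(λ')·exp(ε·ℓ'(λ')/(2Δ)). Then for every λ ∈ Λ, P(λ) ≤ exp(ε)·P'(λ). -/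
/-- Raising a score by at most `Δ` multiplies its exponential weight by at most `exp (ε / 2)`. -/
theorem exp_weight_le_exp_half_mul {ε Δ w a b : ℝ} (hε : 0 ≤ ε) (hΔ : 0 < Δ) (hw : 0 ≤ w)
    (hab : a - b ≤ Δ) :
    w * Real.exp (ε * a / (2 * Δ)) ≤ Real.exp (ε / 2) * (w * Real.exp (ε * b / (2 * Δ))) := by
  rw [mul_left_comm, ← Real.exp_add]
  refine mul_le_mul_of_nonneg_left (Real.exp_le_exp.mpr ?_) hw
  have h : ε / 2 + ε * b / (2 * Δ) = ε * (Δ + b) / (2 * Δ) := by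
    field_simp
  rw [h]
  gcongr
  linarith

/-- The exponential mechanism is ε-differentially private: if two score
functions `ℓ` and `ℓ'` differ by at most `Δ` at every output (global
sensitivity), then the output probabilities of the exponential mechanisms
built from them (with prior weights `pr`) satisfy `P l ≤ exp ε * P' l`. -/
theorem exponential_mechanism_eps_dp
    {Λ : Type*} [Fintype Λ] [Nonempty Λ]
    (ε Δ : ℝ) (hε : 0 ≤ ε) (hΔ : 0 < Δ)
    (pr ℓ ℓ' : Λ → ℝ) (hpr : ∀ l, 0 < pr l)
    (hsens : ∀ l, |ℓ l - ℓ' l| ≤ Δ)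
    (P P' : Λ → ℝ)
    (hP : ∀ l, P l =
      pr l * Real.exp (ε * ℓ l / (2 * Δ)) /
        ∑ l' : Λ, pr l' * Real.exp (ε * ℓ l' / (2 * Δ)))
    (hP' : ∀ l, P' l =
      pr l * Real.exp (ε * ℓ' l / (2 * Δ)) /
        ∑ l' : Λ, pr l' * Real.exp (ε * ℓ' l' / (2 * Δ))) :
    ∀ l : Λ, P l ≤ Real.exp ε * P' l := by
  intro l
  have hpos (f : Λ → ℝ) : 0 < ∑ l' : Λ, pr l' * Real.exp (ε * f l' / (2 * Δ)) :=
    Finset.sum_pos (fun i _ => mul_pos (hpr i) (Real.exp_pos _)) Finset.univ_nonempty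
  have hnum := exp_weight_le_exp_half_mul hε hΔ (hpr l).le (abs_le.mp (hsens l)).2
  have hden : ∑ l' : Λ, pr l' * Real.exp (ε * ℓ' l' / (2 * Δ)) ≤
      Real.exp (ε / 2) * ∑ l' : Λ, pr l' * Real.exp (ε * ℓ l' / (2 * Δ)) := by
    rw [Finset.mul_sum]
    refine Finset.sum_le_sum fun i _ => exp_weight_le_exp_half_mul hε hΔ (hpr i).le ?_
    linarith [(abs_le.mp (hsens i)).1]
  rw [hP, hP', ← mul_div_assoc, div_le_div_iff₀ (hpos ℓ) (hpos ℓ')]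
  refine (mul_le_mul hnum hden (hpos ℓ').le ((mul_pos (hpr l) (Real.exp_pos _)).le.trans
    hnum)).trans_eq ?_
  rw [← add_halves ε, Real.exp_add, add_halves]
  ring
end

section
/- Let (Ω, 𝓕, P) be a probability space, let ε ≥ 0 and δ ∈ [0,1], and let A, B, E be events with P(E) > 0, P(E) ≥ 1 − δ, and P(A | E) ≤ exp(ε)·P(B | E). Then P(A) ≤ exp(ε)·P(B) + δ. -/
open MeasureTheory

/-- If a mechanism is ε-DP conditional on a high-probability event `E`
(with `P E ≥ 1 - δ`), then it is (ε, δ)-DP unconditionally: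
from `P(A|E) ≤ exp(ε)·P(B|E)` and `P E ≥ 1 - δ` we get
`P A ≤ exp(ε)·P B + δ`. -/
theorem conditional_dp_implies_unconditional_dp
    {Ω : Type*} [MeasurableSpace Ω] (P : Measure Ω) [IsProbabilityMeasure P]
    (A B E : Set Ω) (hA : MeasurableSet A) (hB : MeasurableSet B)
    (hE : MeasurableSet E)
    (ε δ : ℝ) (hε : 0 ≤ ε) (hδ0 : 0 ≤ δ) (hδ1 : δ ≤ 1)
    (hEpos : 0 < P E)
    (hEhigh : 1 - ENNReal.ofReal δ ≤ P E)
    (hcond : P (A ∩ E) / P E ≤ ENNReal.ofReal (Real.exp ε) * (P (B ∩ E) / P E)) :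
    P A ≤ ENNReal.ofReal (Real.exp ε) * P B + ENNReal.ofReal δ := by
  have hinter : P (A ∩ E) ≤ ENNReal.ofReal (Real.exp ε) * P (B ∩ E) := by
    rw [← mul_div_assoc, ENNReal.div_le_iff hEpos.ne' (measure_ne_top P E),
      ENNReal.div_mul_cancel hEpos.ne' (measure_ne_top P E)] at hcond
    exact hcond
  have hcompl : P Eᶜ ≤ ENNReal.ofReal δ := by
    rw [prob_compl_eq_one_sub hE]
    exact tsub_le_iff_tsub_le.mp hEhigh
  calc P A ≤ P (A ∩ E) + P (A \ E) := measure_le_inter_add_sdiff P A E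
    _ ≤ ENNReal.ofReal (Real.exp ε) * P B + ENNReal.ofReal δ := by
      gcongr
      · exact hinter.trans (by gcongr; exact Set.inter_subset_left)
      · exact (measure_mono fun _ hx => hx.2).trans hcompl
end

section
/- Let Λ be a finite nonempty set, let δ ∈ (0,1), and for each integer t ≥ 1 set φ_t = 2·log(|Λ|·t²·π²/(6δ)). Let (Ω, 𝓕, P) be a probability space and for each t ≥ 1 and λ ∈ Λ let X_{t,λ} be a real-valued random variable, with reals μ_{t,λ} and σ_{t,λ} > 0, satisfying P(|X_{t,λ} − μ_{t,λ}| > √φ_t·σ_{t,λ}) ≤ exp(−φ_t/2). Then P(for all t ≥ 1 and all λ ∈ Λ, |X_{t,λ} − μ_{t,λ}| ≤ √φ_t·σ_{t,λ}) ≥ 1 − δ. -/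
open MeasureTheory

/-- The Basel series, indexed by the positive integers. -/
theorem hasSum_pnat_one_div_sq :
    HasSum (fun t : ℕ+ => 1 / (t : ℝ) ^ 2) (Real.pi ^ 2 / 6) := by
  refine (PNat.coe_injective.hasSum_iff (f := fun n : ℕ => 1 / (n : ℝ) ^ 2) ?_).2
    hasSum_zeta_two
  intro n hn
  obtain rfl : n = 0 := by
    by_contra h
    exact hn ⟨⟨n, Nat.pos_of_ne_zero h⟩, rfl⟩
  simp

/-- **Union bound** over a countable family, with a summable real-valued bound on the
probabilities of the complementary events. -/
theorem one_sub_le_measure_forall_of_hasSum {Ω ι κ : Type*} [MeasurableSpace Ω]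
    (P : Measure Ω) [IsProbabilityMeasure P] [Countable ι] [Fintype κ]
    (good : ι → κ → Ω → Prop) (b : ι → ℝ) (hb : ∀ i, 0 ≤ b i) {δ : ℝ}
    (hsum : HasSum (fun i => Fintype.card κ * b i) δ)
    (hbad : ∀ i k, P {ω | ¬ good i k ω} ≤ ENNReal.ofReal (b i)) :
    1 - ENNReal.ofReal δ ≤ P {ω | ∀ i k, good i k ω} := by
  have hcompl : P {ω | ∀ i k, good i k ω}ᶜ ≤ ENNReal.ofReal δ := by
    calc P {ω | ∀ i k, good i k ω}ᶜ
        = P (⋃ i, ⋃ k, {ω | ¬ good i k ω}) := by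
          congr 1
          ext ω
          simp
      _ ≤ ∑' i, ∑ k, P {ω | ¬ good i k ω} :=
          (measure_iUnion_le _).trans
            (ENNReal.tsum_le_tsum fun i => measure_iUnion_fintype_le P _)
      _ ≤ ∑' i, ENNReal.ofReal (Fintype.card κ * b i) := by
          refine ENNReal.tsum_le_tsum fun i =>
            (Finset.sum_le_sum fun k _ => hbad i k).trans_eq ?_
          simp [ENNReal.ofReal_mul]
      _ = ENNReal.ofReal δ := by
          rw [← ENNReal.ofReal_tsum_of_nonneg
            (fun i => mul_nonneg (Nat.cast_nonneg _) (hb i)) hsum.summable, hsum.tsum_eq]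
  rw [tsub_le_iff_right, ← measure_univ (μ := P),
    ← Set.union_compl_self {ω | ∀ i k, good i k ω}]
  exact (measure_union_le _ _).trans (by gcongr)

/-- Uniform-over-iterations GP-UCB confidence bound (Lemma 3.1 of the paper,
Lemma 5.1 of Srinivas et al.): with the schedule
`φ t = 2·log(|Λ|·t²·π²/(6δ))`, if at each iteration `t ≥ 1` every point
`l ∈ Λ` satisfies the single-point concentration bound with parameter `φ t`,
then the confidence bands hold simultaneously for all `t` and all `l` with
probability at least `1 − δ`. -/
theorem gp_ucb_uniform_confidence
    {Ω : Type*} [MeasurableSpace Ω] (P : Measure Ω) [IsProbabilityMeasure P]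
    {Λ : Type*} [Fintype Λ] [Nonempty Λ]
    (δ : ℝ) (hδ0 : 0 < δ) (hδ1 : δ < 1)
    (φ : ℕ+ → ℝ)
    (hφ : ∀ t : ℕ+, φ t =
      2 * Real.log ((Fintype.card Λ : ℝ) * (t : ℝ) ^ 2 * Real.pi ^ 2 / (6 * δ)))
    (X : ℕ+ → Λ → Ω → ℝ) (hX : ∀ t l, Measurable (X t l))
    (μ : ℕ+ → Λ → ℝ) (σ : ℕ+ → Λ → ℝ) (hσ : ∀ t l, 0 < σ t l)
    (htail : ∀ t l, P {ω | Real.sqrt (φ t) * σ t l < |X t l ω - μ t l|} ≤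
      ENNReal.ofReal (Real.exp (-(φ t) / 2))) :
    1 - ENNReal.ofReal δ ≤
      P {ω | ∀ (t : ℕ+) (l : Λ), |X t l ω - μ t l| ≤ Real.sqrt (φ t) * σ t l} := by
  have hcard : (0 : ℝ) < Fintype.card Λ := Nat.cast_pos.2 Fintype.card_pos
  have hexp (t : ℕ+) : Fintype.card Λ * Real.exp (-(φ t) / 2)
      = 6 * δ / Real.pi ^ 2 * (1 / (t : ℝ) ^ 2) := by
    have ht : (0 : ℝ) < t := Nat.cast_pos.2 t.pos
    have hpos : 0 < (Fintype.card Λ : ℝ) * (t : ℝ) ^ 2 * Real.pi ^ 2 / (6 * δ) := by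
      positivity
    rw [hφ, neg_div, mul_div_cancel_left₀ _ two_ne_zero, Real.exp_neg, Real.exp_log hpos]
    field_simp
  refine one_sub_le_measure_forall_of_hasSum P _ (fun t => Real.exp (-(φ t) / 2))
    (fun t => (Real.exp_pos _).le) ?_ fun t l => ?_
  · simp only [hexp]
    have hδ : 6 * δ / Real.pi ^ 2 * (Real.pi ^ 2 / 6) = δ := by field_simp
    have hsum := hasSum_pnat_one_div_sq.mul_left (6 * δ / Real.pi ^ 2)
    rwa [hδ] at hsum
  · simpa only [not_le] using htail t l
end
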